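/- arXiv:2504.05360 — 5 statements merged into one kernel-verified Lean document; each statement's English description precedes it below -/
import Mathlib

section
/- Let U and V be distinct open strata of (C, Φ) and set k := d(U,V) − 1. Then closure(V) ∩ U_{≤k} = ⋃_{φ ∈ Φ(U,V)} (closure(V) ∩ H_φ). -/
open Set

noncomputable section

abbrev Rn (n : ℕ) : Type := Fin n → ℝ

abbrev AffForm (n : ℕ) : Type := (Rn n) →ᵃ[ℝ] ℝ

/-- A polyhedron: a nonempty intersection of finitely many closed half-spaces. -/
def IsPolyhedron {n : ℕ} (C : Set (Rn n)) : Prop :=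
  C.Nonempty ∧ ∃ Ψ : Finset (AffForm n), (∀ ψ ∈ Ψ, ψ.linear ≠ 0) ∧
    C = {x | ∀ ψ ∈ Ψ, 0 ≤ ψ x}

/-- The stratum of `(C, Φ)` attached to a sign function `ε`. -/
def stratum {n : ℕ} (C : Set (Rn n)) (Φ : Finset (AffForm n)) (ε : AffForm n → ℝ) :
    Set (Rn n) :=
  {x | x ∈ C ∧ ∀ φ ∈ Φ, 0 < ε φ * φ x}

/-- Open strata of `(C, Φ)`: nonempty sets of the form `stratum C Φ ε` for a sign function. -/
def IsOpenStratum {n : ℕ} (C : Set (Rn n)) (Φ : Finset (AffForm n)) (U : Set (Rn n)) : Prop :=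
  U.Nonempty ∧ ∃ ε : AffForm n → ℝ, (∀ φ, ε φ = 1 ∨ ε φ = -1) ∧ U = stratum C Φ ε

/-- `φ` separates `U` and `V` if it is strictly positive on one and strictly negative
on the other. -/
def Separates {n : ℕ} (φ : AffForm n) (U V : Set (Rn n)) : Prop :=
  ((∀ x ∈ U, 0 < φ x) ∧ (∀ x ∈ V, φ x < 0)) ∨
  ((∀ x ∈ U, φ x < 0) ∧ (∀ x ∈ V, 0 < φ x))

/-- `Φ(U,V)`: the set of forms in `Φ` separating `U` and `V`. -/
def sepSet {n : ℕ} (Φ : Finset (AffForm n)) (U V : Set (Rn n)) : Set (AffForm n) :=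
  {φ | φ ∈ Φ ∧ Separates φ U V}

/-- `d(U,V)`: the number of forms in `Φ` separating `U` and `V`. -/
def sdist {n : ℕ} (Φ : Finset (AffForm n)) (U V : Set (Rn n)) : ℕ :=
  (sepSet Φ U V).ncard

/-- `U_{≤ k}`: the union of the closures of the open strata `W` with `d(U,W) ≤ k`. -/
def below {n : ℕ} (C : Set (Rn n)) (Φ : Finset (AffForm n)) (U : Set (Rn n)) (k : ℕ) :
    Set (Rn n) :=
  ⋃ W ∈ {W | IsOpenStratum C Φ W ∧ sdist Φ U W ≤ k}, closure W


theorem sepSet_iff_aux {n : ℕ} {C : Set (Rn n)} {Φ : Finset (AffForm n)}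
    {ε η : AffForm n → ℝ} (hε : ∀ φ, ε φ = 1 ∨ ε φ = -1) (hη : ∀ φ, η φ = 1 ∨ η φ = -1)
    (h1 : (stratum C Φ ε).Nonempty) (h2 : (stratum C Φ η).Nonempty) (φ : AffForm n) :
    φ ∈ sepSet Φ (stratum C Φ ε) (stratum C Φ η) ↔ φ ∈ Φ ∧ ε φ ≠ η φ := by
  obtain ⟨u, hu⟩ := h1
  obtain ⟨v, hv⟩ := h2
  constructor
  · rintro ⟨hφ, h⟩
    refine ⟨hφ, fun he => ?_⟩
    have hu' := hu.2 φ hφ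
    have hv' := hv.2 φ hφ
    rw [← he] at hv'
    rcases h with ⟨ha, hb⟩ | ⟨ha, hb⟩ <;> have := ha u hu <;> have := hb v hv <;>
      rcases hε φ with h | h <;> rw [h] at hu' hv' <;> linarith
  · rintro ⟨hφ, h⟩
    refine ⟨hφ, ?_⟩
    rcases hε φ with h1 | h1 <;> rcases hη φ with h2 | h2
    · exact absurd (h1.trans h2.symm) h
    · left
      constructor <;> intro x hx <;> have := hx.2 φ hφ
      · rw [h1] at this; linarith
      · rw [h2] at this; linarith
    · right
      constructor <;> intro x hx <;> have := hx.2 φ hφ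
      · rw [h1] at this; linarith
      · rw [h2] at this; linarith
    · exact absurd (h1.trans h2.symm) h

theorem sepSet_finite_aux {n : ℕ} (Φ : Finset (AffForm n)) (U V : Set (Rn n)) :
    (sepSet Φ U V).Finite := Φ.finite_toSet.subset fun _ h => h.1

theorem closure_sign_aux {n : ℕ} {C : Set (Rn n)} {Φ : Finset (AffForm n)}
    {ε : AffForm n → ℝ} {x : Rn n} (hx : x ∈ closure (stratum C Φ ε)) {φ : AffForm n}
    (hφ : φ ∈ Φ) : 0 ≤ ε φ * φ x := by
  have hc : Continuous (φ : Rn n → ℝ) := φ.continuous_of_finiteDimensional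
  have hcl : IsClosed {y : Rn n | 0 ≤ ε φ * φ y} :=
    isClosed_le continuous_const (continuous_const.mul hc)
  exact closure_minimal (fun y hy => (hy.2 φ hφ).le) hcl hx

/-- Let `U` and `V` be distinct open strata of `(C, Φ)` and set `k := d(U,V) - 1`.  Then
`closure V ∩ U_{≤ k} = ⋃_{φ ∈ Φ(U,V)} (closure V ∩ H_φ)`. -/
theorem closure_inter_below_eq {n : ℕ} (C : Set (Rn n)) (Φ : Finset (AffForm n))
    (hC : IsPolyhedron C) (hΦ : ∀ φ ∈ Φ, φ.linear ≠ 0)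
    (U V : Set (Rn n)) (hU : IsOpenStratum C Φ U) (hV : IsOpenStratum C Φ V)
    (hUV : U ≠ V) :
    closure V ∩ below C Φ U (sdist Φ U V - 1) =
      ⋃ φ ∈ sepSet Φ U V, closure V ∩ {x | φ x = 0} := by
  classical
  obtain ⟨hUn, ε, hε, rfl⟩ := hU
  obtain ⟨hVn, η, hη, rfl⟩ := hV
  ext x
  simp only [below, mem_inter_iff, mem_iUnion, mem_setOf_eq, exists_prop]
  constructor
  · rintro ⟨hxV, W, ⟨⟨hWn, ω, hω, rfl⟩, hd⟩, hxW⟩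
    have hpos : 0 < sdist Φ (stratum C Φ ε) (stratum C Φ η) := by
      rw [sdist, Set.ncard_pos (sepSet_finite_aux _ _ _)]
      by_contra hne
      rw [Set.not_nonempty_iff_eq_empty] at hne
      apply hUV
      have key : ∀ φ ∈ Φ, ε φ = η φ := by
        intro φ hφ
        by_contra h
        have := (sepSet_iff_aux hε hη hUn hVn φ).2 ⟨hφ, h⟩
        rw [hne] at this
        exact this
      ext y
      constructor
      · exact fun hy => ⟨hy.1, fun φ hφ => key φ hφ ▸ hy.2 φ hφ⟩
      · exact fun hy => ⟨hy.1, fun φ hφ => (key φ hφ).symm ▸ hy.2 φ hφ⟩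
    have : ¬ sepSet Φ (stratum C Φ ε) (stratum C Φ η) ⊆
        sepSet Φ (stratum C Φ ε) (stratum C Φ ω) := by
      intro hs
      have := Set.ncard_le_ncard hs (sepSet_finite_aux _ _ _)
      unfold sdist at hd hpos
      omega
    obtain ⟨φ, h1, h2⟩ := Set.not_subset.1 this
    refine ⟨φ, h1, hxV, ?_⟩
    rw [sepSet_iff_aux hε hη hUn hVn] at h1
    rw [sepSet_iff_aux hε hω hUn hWn] at h2
    have h3 : ε φ = ω φ := by
      by_contra h
      exact h2 ⟨h1.1, h⟩
    have h4 := closure_sign_aux hxV h1.1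
    have h5 := closure_sign_aux hxW h1.1
    have h6 := h1.2
    rw [h3] at h6
    rcases hη φ with a | a <;> rcases hω φ with b | b <;> rw [a] at h4 h6 <;>
      rw [b] at h5 h6 <;> first | exact absurd rfl h6 | linarith
  · rintro ⟨φ, hφ, hxV, hx0⟩
    refine ⟨hxV, ?_⟩
    obtain ⟨u, hu⟩ := hUn
    have hUn : (stratum C Φ ε).Nonempty := ⟨u, hu⟩
    obtain ⟨-, Ψ, -, hCΨ⟩ := hC
    have hxC : ∀ ψ ∈ Ψ, 0 ≤ ψ x := by
      intro ψ hψ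
      have hcl : IsClosed {y : Rn n | 0 ≤ ψ y} :=
        isClosed_le continuous_const ψ.continuous_of_finiteDimensional
      refine closure_minimal (fun y hy => ?_) hcl hxV
      have := hy.1
      rw [hCΨ] at this
      exact this ψ hψ
    have huC : ∀ ψ ∈ Ψ, 0 ≤ ψ u := by
      have := hu.1
      rw [hCΨ] at this
      exact this
    let ω : AffForm n → ℝ := fun ψ => if ψ x = 0 then ε ψ else η ψ
    have hω : ∀ ψ, ω ψ = 1 ∨ ω ψ = -1 := by
      intro ψ
      by_cases h : ψ x = 0
      · simpa [ω, h] using hε ψ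
      · simpa [ω, h] using hη ψ
    let p : ℝ → Rn n := fun t => AffineMap.lineMap x u t
    have hpc : Continuous p := AffineMap.lineMap_continuous
    have hp0 : p 0 = x := AffineMap.lineMap_apply_zero x u
    have hpv : ∀ (ψ : AffForm n) t, ψ (p t) = (1 - t) * ψ x + t * ψ u := by
      intro ψ t
      have h := AffineMap.apply_lineMap ψ x u t
      rw [AffineMap.lineMap_apply_module (ψ x)] at h
      exact h
    have hpt : Filter.Tendsto p (nhdsWithin 0 (Ioi 0)) (nhds x) := by
      have := hpc.tendsto 0
      rw [hp0] at this
      exact this.mono_left nhdsWithin_le_nhds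
    have hev : ∀ᶠ t in nhdsWithin (0:ℝ) (Ioi 0), p t ∈ stratum C Φ ω := by
      have e1 : ∀ᶠ t in nhdsWithin (0:ℝ) (Ioi 0), 0 < t := self_mem_nhdsWithin
      have e2 : ∀ᶠ t in nhdsWithin (0:ℝ) (Ioi 0), t < 1 :=
        nhdsWithin_le_nhds (Iio_mem_nhds one_pos)
      have e3 : ∀ᶠ t in nhdsWithin (0:ℝ) (Ioi 0), ∀ ψ ∈ Φ, 0 < ω ψ * ψ (p t) := by
        rw [Filter.eventually_all_finset]
        intro ψ hψ
        by_cases h : ψ x = 0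
        · filter_upwards [e1] with t ht
          have := hu.2 ψ hψ
          have h' : ω ψ = ε ψ := by simp [ω, h]
          rw [h', hpv, h]
          nlinarith [mul_pos ht this]
        · have h' : ω ψ = η ψ := by simp [ω, h]
          have hpos : 0 < ω ψ * ψ x := by
            rw [h']
            refine lt_of_le_of_ne (closure_sign_aux hxV hψ) (Ne.symm (mul_ne_zero ?_ h))
            rcases hη ψ with a | a <;> rw [a] <;> norm_num
          have hc : Continuous (ψ : Rn n → ℝ) := ψ.continuous_of_finiteDimensional
          have ht : Filter.Tendsto (fun t => ω ψ * ψ (p t)) (nhdsWithin 0 (Ioi 0))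
              (nhds (ω ψ * ψ x)) := ((hc.tendsto x).comp hpt).const_mul _
          exact ht.eventually (Ioi_mem_nhds hpos)
      filter_upwards [e1, e2, e3] with t h1 h2 h3
      refine ⟨?_, h3⟩
      rw [hCΨ]
      intro ψ hψ
      rw [hpv]
      have := hxC ψ hψ
      have := huC ψ hψ
      have : 0 ≤ 1 - t := by linarith
      positivity
    have hWn : (stratum C Φ ω).Nonempty := by
      obtain ⟨t, ht⟩ := hev.exists
      exact ⟨_, ht⟩
    refine ⟨stratum C Φ ω, ⟨⟨hWn, ω, hω, rfl⟩, ?_⟩, mem_closure_of_tendsto hpt hev⟩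
    apply Nat.le_sub_one_of_lt
    refine Set.ncard_lt_ncard ?_ (sepSet_finite_aux _ _ _)
    rw [Set.ssubset_iff_of_subset]
    · refine ⟨φ, hφ, fun h => ?_⟩
      rw [sepSet_iff_aux hε hω hUn hWn] at h
      exact h.2 (by simp [ω, hx0])
    · intro ψ h
      rw [sepSet_iff_aux hε hω hUn hWn] at h
      rw [sepSet_iff_aux hε hη hUn hVn]
      refine ⟨h.1, fun he => h.2 ?_⟩
      by_cases hz : ψ x = 0 <;> simp [ω, hz, he]

end
end

section
/- Let U and V be distinct open strata of (C, Φ) and set k := d(U,V) − 1. Then closure(V) ∩ U_{≤k} is nonempty and closure(V) deformation retracts onto it: there is a continuous map H : closure(V) × [0,1] → closure(V) with H(y,0) = y and H(y,1) ∈ closure(V) ∩ U_{≤k} for every y ∈ closure(V), and H(y,s) = y for every y ∈ closure(V) ∩ U_{≤k} and every s ∈ [0,1]. In particular, closure(V) ∩ U_{≤k} (with the subspace topology) is a contractible topological space. -/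
open Set

noncomputable section

lemma cdr_line {n : ℕ} (φ : AffForm n) (y u : Rn n) (t : ℝ) :
    φ (AffineMap.lineMap y u t) = (1 - t) * φ y + t * φ u := by
  rw [AffineMap.apply_lineMap, AffineMap.lineMap_apply_module]
  simp

lemma cdr_cont {n : ℕ} (φ : AffForm n) : Continuous φ :=
  AffineMap.continuous_of_finiteDimensional φ

lemma cdr_poly_line {n : ℕ} {C : Set (Rn n)} (hC : IsPolyhedron C) {y u : Rn n}
    (hy : y ∈ C) (hu : u ∈ C) {t : ℝ} (h0 : 0 ≤ t) (h1 : t ≤ 1) :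
    AffineMap.lineMap y u t ∈ C := by
  obtain ⟨_, Ψ, _, rfl⟩ := hC
  intro ψ hψ
  rw [cdr_line]
  have := mul_nonneg (sub_nonneg.2 h1) (hy ψ hψ)
  have := mul_nonneg h0 (hu ψ hψ)
  linarith

lemma cdr_poly_closed {n : ℕ} {C : Set (Rn n)} (hC : IsPolyhedron C) : IsClosed C := by
  obtain ⟨_, Ψ, _, rfl⟩ := hC
  simp only [Set.setOf_forall]
  exact isClosed_biInter fun ψ _ => isClosed_le continuous_const (cdr_cont ψ)

lemma cdr_tendsto {n : ℕ} (y u : Rn n) :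
    Filter.Tendsto (fun t : ℝ => (AffineMap.lineMap y u t : Rn n)) (nhdsWithin 0 (Set.Ioi 0))
      (nhds y) := by
  have h : Continuous (fun t : ℝ => (AffineMap.lineMap y u t : Rn n)) :=
    AffineMap.lineMap_continuous
  have := h.tendsto 0
  rw [AffineMap.lineMap_apply_zero] at this
  exact this.mono_left nhdsWithin_le_nhds

lemma cdr_small : ∀ᶠ t : ℝ in nhdsWithin 0 (Set.Ioi 0), 0 < t ∧ t < 1 := by
  filter_upwards [Ioo_mem_nhdsGT (zero_lt_one' ℝ)] with t ht using ht

lemma cdr_closure {n : ℕ} {C : Set (Rn n)} {Φ : Finset (AffForm n)} (hC : IsPolyhedron C)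
    {ε : AffForm n → ℝ} (hne : (stratum C Φ ε).Nonempty) (y : Rn n) :
    y ∈ closure (stratum C Φ ε) ↔ y ∈ C ∧ ∀ φ ∈ Φ, 0 ≤ ε φ * φ y := by
  constructor
  · have hcl : IsClosed {y | y ∈ C ∧ ∀ φ ∈ Φ, 0 ≤ ε φ * φ y} := by
      refine (cdr_poly_closed hC).inter (s₂ := {y | ∀ φ ∈ Φ, 0 ≤ ε φ * φ y}) ?_
      simp only [Set.setOf_forall]
      exact isClosed_biInter fun ψ _ =>
        isClosed_le continuous_const (continuous_const.mul (cdr_cont ψ))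
    intro h
    exact closure_minimal (t := {y | y ∈ C ∧ ∀ φ ∈ Φ, 0 ≤ ε φ * φ y})
      (fun x hx => ⟨hx.1, fun φ hφ => (hx.2 φ hφ).le⟩) hcl h
  · rintro ⟨hy, hφ⟩
    obtain ⟨v, hv⟩ := hne
    refine mem_closure_of_tendsto (cdr_tendsto y v) ?_
    filter_upwards [cdr_small] with t ht
    refine ⟨cdr_poly_line hC hy hv.1 ht.1.le ht.2.le, fun φ h => ?_⟩
    rw [cdr_line]
    have h1 := mul_nonneg (sub_nonneg.2 ht.2.le) (hφ φ h)
    have h2 := mul_pos ht.1 (hv.2 φ h)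
    nlinarith

lemma cdr_sep {n : ℕ} {C : Set (Rn n)} {Φ : Finset (AffForm n)}
    {ε δ : AffForm n → ℝ} (hε : ∀ φ, ε φ = 1 ∨ ε φ = -1) (hδ : ∀ φ, δ φ = 1 ∨ δ φ = -1)
    (hU : (stratum C Φ ε).Nonempty) (hV : (stratum C Φ δ).Nonempty) :
    sepSet Φ (stratum C Φ ε) (stratum C Φ δ) = {φ | φ ∈ Φ ∧ ε φ ≠ δ φ} := by
  ext φ
  refine and_congr_right fun hφ => ?_
  obtain ⟨u, hu⟩ := hU
  obtain ⟨v, hv⟩ := hV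
  have hu' := hu.2 φ hφ
  have hv' := hv.2 φ hφ
  constructor
  · intro h heq
    rcases h with h | h
    · have h1 := h.1 u hu
      have h2 := h.2 v hv
      rw [heq] at hu'
      rcases hδ φ with e | e <;> rw [e] at hu' hv' <;> linarith
    · have h1 := h.1 u hu
      have h2 := h.2 v hv
      rw [heq] at hu'
      rcases hδ φ with e | e <;> rw [e] at hu' hv' <;> linarith
  · intro hne
    rcases hε φ with e | e <;> rcases hδ φ with d | d
    · exact absurd (e.trans d.symm) hne
    · left
      refine ⟨fun x hx => ?_, fun x hx => ?_⟩ <;> have := hx.2 φ hφ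
      · rw [e] at this; linarith
      · rw [d] at this; linarith
    · right
      refine ⟨fun x hx => ?_, fun x hx => ?_⟩ <;> have := hx.2 φ hφ
      · rw [e] at this; linarith
      · rw [d] at this; linarith
    · exact absurd (e.trans d.symm) hne

lemma cdr_below {n : ℕ} {C : Set (Rn n)} {Φ : Finset (AffForm n)} (hC : IsPolyhedron C)
    {ε δ : AffForm n → ℝ} (hε : ∀ φ, ε φ = 1 ∨ ε φ = -1) (hδ : ∀ φ, δ φ = 1 ∨ δ φ = -1)
    (hU : (stratum C Φ ε).Nonempty) (hV : (stratum C Φ δ).Nonempty)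
    (hne : ∃ φ ∈ Φ, ε φ ≠ δ φ) {y : Rn n} (hy : y ∈ closure (stratum C Φ δ)) :
    y ∈ below C Φ (stratum C Φ ε) (sdist Φ (stratum C Φ ε) (stratum C Φ δ) - 1) ↔
      ∃ φ ∈ Φ, ε φ ≠ δ φ ∧ φ y = 0 := by
  classical
  have hfin : {φ | φ ∈ Φ ∧ ε φ ≠ δ φ}.Finite := Φ.finite_toSet.subset fun φ h => h.1
  have hpos : 0 < {φ | φ ∈ Φ ∧ ε φ ≠ δ φ}.ncard := by
    obtain ⟨φ, h⟩ := hne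
    exact (Set.ncard_pos hfin).2 ⟨φ, h⟩
  have hy' := (cdr_closure hC hV y).1 hy
  simp only [below, Set.mem_iUnion, Set.mem_setOf_eq, exists_prop]
  rw [sdist, cdr_sep hε hδ hU hV]
  constructor
  · rintro ⟨W, ⟨⟨hW, η, hη, rfl⟩, hd⟩, hyW⟩
    rw [sdist, cdr_sep hε hη hU hW] at hd
    have hyW' := (cdr_closure hC hW y).1 hyW
    by_contra hcon
    push Not at hcon
    have hsub : {φ | φ ∈ Φ ∧ ε φ ≠ δ φ} ⊆ {φ | φ ∈ Φ ∧ ε φ ≠ η φ} := by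
      rintro φ ⟨hφ, h⟩
      refine ⟨hφ, ?_⟩
      have h0 := hcon φ hφ h
      have h1 := hy'.2 φ hφ
      have h2 := hyW'.2 φ hφ
      suffices η φ = δ φ by rwa [this]
      rcases hη φ with e | e <;> rcases hδ φ with d | d <;> rw [e] at h2 ⊢ <;> rw [d] at h1 ⊢
      · exact absurd (by linarith) h0
      · exact absurd (by linarith) h0
    have := Set.ncard_le_ncard hsub (Φ.finite_toSet.subset fun φ h => h.1)
    omega
  · rintro ⟨φ₀, hφ₀, hne₀, hz⟩
    obtain ⟨u, hu⟩ := hU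
    let η : AffForm n → ℝ := fun φ => if φ y = 0 then ε φ else δ φ
    have hη : ∀ φ, η φ = 1 ∨ η φ = -1 := by
      intro φ
      by_cases h : φ y = 0
      · simpa [η, h] using hε φ
      · simpa [η, h] using hδ φ
    have hW : (stratum C Φ η).Nonempty := by
      have key : ∀ᶠ t : ℝ in nhdsWithin 0 (Set.Ioi 0),
          ∀ φ ∈ Φ, 0 < η φ * φ (AffineMap.lineMap y u t) := by
        rw [Filter.eventually_all_finset]
        intro φ hφ
        by_cases h : φ y = 0
        · filter_upwards [cdr_small] with t ht
          rw [cdr_line, h]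
          simp only [η, h, if_true]
          have := mul_pos ht.1 (hu.2 φ hφ)
          nlinarith
        · have h1 : 0 < η φ * φ y := by
            simp only [η, h, if_false]
            refine lt_of_le_of_ne (hy'.2 φ hφ) (Ne.symm (mul_ne_zero ?_ h))
            rcases hδ φ with d | d <;> rw [d] <;> norm_num
          have h3 : Continuous fun x : Rn n => η φ * φ x := continuous_const.mul (cdr_cont φ)
          have h2 := (h3.tendsto y).comp (cdr_tendsto y u)
          exact h2.eventually (lt_mem_nhds h1)
      obtain ⟨t, h1, h2⟩ := (key.and cdr_small).exists
      exact ⟨_, cdr_poly_line hC hy'.1 hu.1 h2.1.le h2.2.le, h1⟩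
    refine ⟨stratum C Φ η, ⟨⟨hW, η, hη, rfl⟩, ?_⟩, ?_⟩
    · rw [sdist, cdr_sep hε hη ⟨u, hu⟩ hW]
      have hss : {φ | φ ∈ Φ ∧ ε φ ≠ η φ} ⊂ {φ | φ ∈ Φ ∧ ε φ ≠ δ φ} := by
        refine (Set.ssubset_iff_of_subset ?_).2 ⟨φ₀, ⟨hφ₀, hne₀⟩, fun h => h.2 (by simp [η, hz])⟩
        rintro φ ⟨hφ, h⟩
        refine ⟨hφ, ?_⟩
        by_cases h' : φ y = 0
        · exact absurd (by simp [η, h']) h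
        · simpa [η, h'] using h
      have := Set.ncard_lt_ncard hss hfin
      omega
    · rw [cdr_closure hC hW]
      refine ⟨hy'.1, fun φ hφ => ?_⟩
      by_cases h : φ y = 0
      · simp [h]
      · simpa [η, h] using hy'.2 φ hφ

/-- the time at which the segment from `y` to `u` first meets a separating hyperplane -/
def cdrTau {n : ℕ} (S : Finset (AffForm n)) (hS : S.Nonempty) (u y : Rn n) : ℝ :=
  S.inf' hS fun φ => |φ y| / (|φ y| + |φ u|)

lemma cdr_tau_cont {n : ℕ} (S : Finset (AffForm n)) (hS : S.Nonempty) (u : Rn n)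
    (hu : ∀ φ ∈ S, φ u ≠ 0) : Continuous (cdrTau S hS u) := by
  unfold cdrTau
  refine Continuous.finset_inf'_apply hS fun φ hφ => ?_
  have := cdr_cont φ
  refine Continuous.div (by fun_prop) (by fun_prop) fun y => ?_
  have := abs_pos.2 (hu φ hφ)
  have := abs_nonneg (φ y)
  linarith

lemma cdr_contractible {X : Type*} [TopologicalSpace X] [ContractibleSpace X] {D : Type*}
    [TopologicalSpace D] (i : C(D, X)) (r : C(X, D)) (h : r.comp i = ContinuousMap.id D) :
    ContractibleSpace D := by
  rw [contractible_iff_id_nullhomotopic, ← h]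
  have h1 := (id_nullhomotopic X).comp_right r
  have h2 := h1.comp_left i
  simpa using h2

/-- Let `U` and `V` be distinct open strata of `(C, Φ)` and set `k := d(U,V) - 1`.  Then
`closure V ∩ U_{≤ k}` is nonempty and `closure V` deformation retracts onto it; in
particular `closure V ∩ U_{≤ k}` is a contractible topological space. -/
theorem closure_deformation_retract {n : ℕ} (C : Set (Rn n)) (Φ : Finset (AffForm n))
    (hC : IsPolyhedron C) (hΦ : ∀ φ ∈ Φ, φ.linear ≠ 0)
    (U V : Set (Rn n)) (hU : IsOpenStratum C Φ U) (hV : IsOpenStratum C Φ V)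
    (hUV : U ≠ V) :
    (closure V ∩ below C Φ U (sdist Φ U V - 1)).Nonempty ∧
    (∃ H : C(↥(closure V) × ↥(Set.Icc (0:ℝ) 1), Rn n),
      (∀ y t, H (y, t) ∈ closure V) ∧
      (∀ y : ↥(closure V), H (y, ⟨0, Set.left_mem_Icc.2 (by norm_num)⟩) = (y : Rn n)) ∧
      (∀ y : ↥(closure V), H (y, ⟨1, Set.right_mem_Icc.2 (by norm_num)⟩) ∈
        closure V ∩ below C Φ U (sdist Φ U V - 1)) ∧
      (∀ (y : ↥(closure V)) (t : ↥(Set.Icc (0:ℝ) 1)),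
        (y : Rn n) ∈ closure V ∩ below C Φ U (sdist Φ U V - 1) → H (y, t) = (y : Rn n))) ∧
    ContractibleSpace ↥(closure V ∩ below C Φ U (sdist Φ U V - 1)) := by
  classical
  obtain ⟨hUne, ε, hε, rfl⟩ := hU
  obtain ⟨hVne, δ, hδ, rfl⟩ := hV
  have hne : ∃ φ ∈ Φ, ε φ ≠ δ φ := by
    by_contra hcon
    push Not at hcon
    apply hUV
    ext x
    refine and_congr_right fun _ => forall₂_congr fun φ hφ => ?_
    rw [hcon φ hφ]
  have hB := fun {y} hy => cdr_below hC hε hδ hUne hVne hne (y := y) hy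
  have hcl := cdr_closure hC hVne (Φ := Φ)
  generalize below C Φ (stratum C Φ ε)
    (sdist Φ (stratum C Φ ε) (stratum C Φ δ) - 1) = B at hB ⊢
  obtain ⟨u, hu⟩ := hUne
  set K := closure (stratum C Φ δ) with hK
  let S : Finset (AffForm n) := Φ.filter fun φ => ε φ ≠ δ φ
  have hS : S.Nonempty := by
    obtain ⟨φ, h1, h2⟩ := hne
    exact ⟨φ, Finset.mem_filter.2 ⟨h1, h2⟩⟩
  have hSu : ∀ φ ∈ S, φ u ≠ 0 := by
    intro φ hφ h
    have := hu.2 φ (Finset.mem_filter.1 hφ).1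
    rw [h] at this
    simp at this
  have hpos : ∀ (y : Rn n), ∀ φ ∈ S, 0 < |φ y| + |φ u| := by
    intro y φ hφ
    have := abs_pos.2 (hSu φ hφ)
    have := abs_nonneg (φ y)
    linarith
  let τ : Rn n → ℝ := cdrTau S hS u
  have hτc : Continuous τ := cdr_tau_cont S hS u hSu
  have hτ0 : ∀ y, 0 ≤ τ y := fun y =>
    Finset.le_inf' _ _ fun φ hφ => div_nonneg (abs_nonneg _) (hpos y φ hφ).le
  have hτle : ∀ y, ∀ φ ∈ S, τ y ≤ |φ y| / (|φ y| + |φ u|) := fun y φ hφ =>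
    Finset.inf'_le _ hφ
  have hτ1 : ∀ y, τ y ≤ 1 := by
    intro y
    obtain ⟨φ, hφ⟩ := hS
    refine (hτle y φ hφ).trans ((div_le_one (hpos y φ hφ)).2 ?_)
    have := abs_nonneg (φ u)
    linarith
  -- absolute values on separating forms
  have hayu : ∀ y ∈ K, ∀ φ ∈ S, |φ y| = δ φ * φ y ∧ |φ u| = - (δ φ * φ u) := by
    intro y hy φ hφ
    obtain ⟨h1, h2⟩ := Finset.mem_filter.1 hφ
    have hy' := ((hcl y).1 hy).2 φ h1
    have hu' := hu.2 φ h1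
    rcases hε φ with e | e <;> rcases hδ φ with d | d <;> rw [e] at hu' h2 <;>
      rw [d] at hy' h2 ⊢
    · exact absurd rfl h2
    · rw [abs_of_nonpos (by linarith), abs_of_nonneg (by linarith)]
      constructor <;> ring
    · rw [abs_of_nonneg (by linarith), abs_of_nonpos (by linarith)]
      constructor <;> ring
    · exact absurd rfl h2
  have hmem : ∀ y ∈ K, ∀ t : ℝ, 0 ≤ t → t ≤ τ y → (AffineMap.lineMap y u t : Rn n) ∈ K := by
    intro y hy t h0 h1
    have hy' := (hcl y).1 hy
    have ht1 := h1.trans (hτ1 y)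
    rw [hcl]
    refine ⟨cdr_poly_line hC hy'.1 hu.1 h0 ht1, fun φ hφ => ?_⟩
    rw [cdr_line]
    by_cases h : ε φ = δ φ
    · have a := mul_nonneg (sub_nonneg.2 ht1) (hy'.2 φ hφ)
      have b := mul_nonneg h0 (hu.2 φ hφ).le
      rw [h] at b
      linarith
    · have hφS : φ ∈ S := Finset.mem_filter.2 ⟨hφ, h⟩
      have a := h1.trans (hτle y φ hφS)
      rw [le_div_iff₀ (hpos y φ hφS), (hayu y hy φ hφS).1, (hayu y hy φ hφS).2] at a
      linarith
  have hend : ∀ y ∈ K, (AffineMap.lineMap y u (τ y) : Rn n) ∈ K ∩ B := by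
    intro y hy
    have h1 := hmem y hy _ (hτ0 y) le_rfl
    refine ⟨h1, (hB h1).2 ?_⟩
    obtain ⟨φ, hφ, he⟩ := Finset.exists_mem_eq_inf' hS fun φ => |φ y| / (|φ y| + |φ u|)
    have he' : τ y = |φ y| / (|φ y| + |φ u|) := he
    refine ⟨φ, (Finset.mem_filter.1 hφ).1, (Finset.mem_filter.1 hφ).2, ?_⟩
    rw [cdr_line]
    rw [eq_div_iff (hpos y φ hφ).ne', (hayu y hy φ hφ).1, (hayu y hy φ hφ).2] at he'
    rcases hδ φ with d | d <;> rw [d] at he' <;> linarith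
  have hfix : ∀ y ∈ K ∩ B, τ y = 0 := by
    rintro y ⟨hy, hyB⟩
    obtain ⟨φ, h1, h2, h3⟩ := (hB hy).1 hyB
    have := hτle y φ (Finset.mem_filter.2 ⟨h1, h2⟩)
    rw [h3] at this
    simp only [abs_zero, zero_div] at this
    exact le_antisymm this (hτ0 y)
  have hKne : K.Nonempty := hVne.closure
  have hKconv : Convex ℝ K := by
    refine Convex.closure ?_
    rw [convex_iff_segment_subset]
    rintro x hx y hy z hz
    rw [segment_eq_image_lineMap] at hz
    obtain ⟨t, ht, rfl⟩ := hz
    refine ⟨cdr_poly_line hC hx.1 hy.1 ht.1 ht.2, fun φ hφ => ?_⟩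
    rw [cdr_line]
    have a := hx.2 φ hφ
    have b := hy.2 φ hφ
    have c := sub_nonneg.2 ht.2
    rcases ht.1.eq_or_lt with h | h
    · rw [← h]; simpa using a
    · have := mul_nonneg c a.le
      have := mul_pos h b
      linarith
  have hLc : Continuous fun p : Rn n × ℝ => (AffineMap.lineMap p.1 u p.2 : Rn n) := by
    simp only [AffineMap.lineMap_apply_module]
    fun_prop
  refine ⟨?_, ?_, ?_⟩
  · obtain ⟨y, hy⟩ := hKne
    exact ⟨_, hend y hy⟩
  · refine ⟨⟨fun p => AffineMap.lineMap (p.1 : Rn n) u ((p.2 : ℝ) * τ p.1), ?_⟩, ?_, ?_, ?_, ?_⟩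
    · exact hLc.comp (f := fun p : K × Set.Icc (0:ℝ) 1 => ((p.1 : Rn n), (p.2 : ℝ) * τ p.1))
        (by fun_prop)
    · intro y t
      exact hmem y y.2 _ (mul_nonneg t.2.1 (hτ0 _)) (mul_le_of_le_one_left (hτ0 _) t.2.2)
    · intro y
      simp
    · intro y
      simpa using hend y y.2
    · intro y t hy
      simp [hfix y hy]
  · haveI : ContractibleSpace K := hKconv.contractibleSpace hKne
    refine cdr_contractible (X := K) (D := ↥(K ∩ B))
      ⟨fun y => ⟨y, y.2.1⟩, by fun_prop⟩
      ⟨fun y => ⟨AffineMap.lineMap (y : Rn n) u (τ y), hend y y.2⟩, ?_⟩ ?_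
    · refine Continuous.subtype_mk ?_ _
      exact hLc.comp (f := fun y : K => ((y : Rn n), τ y)) (by fun_prop)
    · ext1 y
      apply Subtype.ext
      simp [hfix y y.2]

end
end

section
/- Let K be a simplicial complex on V, let S be a full subcomplex of K with vertex set W, and let P(S) := {σ ∈ K | σ ∩ W ≠ ∅}, partially ordered by inclusion. Then the inclusion functor from the poset S (faces of S ordered by inclusion) into the poset P(S), both regarded as categories, is an initial functor: for every σ ∈ P(S), the comma poset {τ ∈ S | τ ⊆ σ} is nonempty and connected (it has a greatest element). -/
open CategoryTheory Set

/-- A simplicial complex on a type `V`: a set of nonempty finite subsets of `V` (the faces)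
closed under passing to nonempty subsets. -/
structure SimplicialCpx (V : Type*) where
  faces : Set (Set V)
  finite : ∀ σ ∈ faces, σ.Finite
  nonempty : ∀ σ ∈ faces, σ.Nonempty
  down : ∀ σ ∈ faces, ∀ τ, τ ⊆ σ → τ.Nonempty → τ ∈ faces

/-- A subcomplex of `K`: a subset of the faces of `K` closed under passing to nonempty
subsets. -/
def IsSubcomplex {V : Type*} (K : SimplicialCpx V) (S : Set (Set V)) : Prop :=
  S ⊆ K.faces ∧ ∀ σ ∈ S, ∀ τ, τ ⊆ σ → τ.Nonempty → τ ∈ S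

/-- The vertex set of a subcomplex. -/
def vertexSet {V : Type*} (S : Set (Set V)) : Set V := {v | {v} ∈ S}

/-- `S` is full in `K` if for every face `σ` of `K`, the set `σ ∩ vertexSet S` is empty or
is a face of `S`. -/
def IsFull {V : Type*} (K : SimplicialCpx V) (S : Set (Set V)) : Prop :=
  ∀ σ ∈ K.faces, σ ∩ vertexSet S = ∅ ∨ σ ∩ vertexSet S ∈ S

/-- The poset `P(S)` of faces of `K` meeting the vertex set of `S`. -/
def meetingFaces {V : Type*} (K : SimplicialCpx V) (S : Set (Set V)) : Set (Set V) :=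
  {σ | σ ∈ K.faces ∧ σ ∩ vertexSet S ≠ ∅}

/-- Every face of a subcomplex consists of vertices of the subcomplex. -/
theorem face_subset_vertexSet {V : Type*} {K : SimplicialCpx V} {S : Set (Set V)}
    (hS : IsSubcomplex K S) {τ : Set V} (hτ : τ ∈ S) : τ ⊆ vertexSet S := fun v hv =>
  hS.2 τ hτ {v} (Set.singleton_subset_iff.2 hv) ⟨v, rfl⟩

/-- The inclusion of the poset of faces of a subcomplex `S` into the poset `P(S)` of faces
of `K` meeting the vertex set of `S`, as a functor between the associated categories. -/
noncomputable def inclusionFunctor {V : Type*} (K : SimplicialCpx V) (S : Set (Set V))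
    (hS : IsSubcomplex K S) : ↥S ⥤ ↥(meetingFaces K S) :=
  Monotone.functor (f := fun τ : ↥S =>
    (⟨τ.1, hS.1 τ.2, by
        obtain ⟨v, hv⟩ := K.nonempty τ.1 (hS.1 τ.2)
        exact Set.nonempty_iff_ne_empty.1
          ⟨v, hv, face_subset_vertexSet hS τ.2 hv⟩⟩ : ↥(meetingFaces K S)))
    (fun a b h => h)

/-- Let `S` be a full subcomplex of `K`.  Then the inclusion functor from the poset of faces of
`S` into the poset `P(S)` of faces of `K` having nonempty intersection with the vertex set
of `S` is an initial functor. -/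
theorem inclusionFunctor_initial {V : Type*} (K : SimplicialCpx V) (S : Set (Set V))
    (hS : IsSubcomplex K S) (hfull : IsFull K S) :
    (inclusionFunctor K S hS).Initial := by
  refine ⟨fun σ => ?_⟩
  have hmem : σ.1 ∩ vertexSet S ∈ S := (hfull σ.1 σ.2.1).resolve_left σ.2.2
  let T : CostructuredArrow (inclusionFunctor K S hS) σ :=
    CostructuredArrow.mk (Y := (⟨σ.1 ∩ vertexSet S, hmem⟩ : ↥S))
      (homOfLE (show σ.1 ∩ vertexSet S ⊆ σ.1 from Set.inter_subset_left))
  haveI : Nonempty (CostructuredArrow (inclusionFunctor K S hS) σ) := ⟨T⟩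
  have key : ∀ X : CostructuredArrow (inclusionFunctor K S hS) σ, Nonempty (X ⟶ T) := by
    intro X
    have h1 : X.left.1 ⊆ σ.1 := leOfHom X.hom
    have h2 : X.left.1 ⊆ σ.1 ∩ vertexSet S :=
      Set.subset_inter h1 (face_subset_vertexSet hS X.left.2)
    have h3 : X.left ≤ (⟨σ.1 ∩ vertexSet S, hmem⟩ : ↥S) := h2
    exact ⟨CostructuredArrow.homMk (homOfLE h3) (Subsingleton.elim _ _)⟩
  refine zigzag_isConnected fun X Y => ?_
  obtain ⟨f⟩ := key X
  obtain ⟨g⟩ := key Y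
  exact Zigzag.of_hom_inv f g
end

section
/- Let I be a partially ordered type and let f : I → J be a surjective map of underlying types. Assume that for all a, b, a', b' ∈ I, if a < b, f(a) ≠ f(b), f(a') = f(a) and f(b') = f(b), then a' < b'. Then there exists exactly one partial order ⊑ on J such that f is monotone (a ≤ b implies f(a) ⊑ f(b)) and f satisfies the level condition: for all a, b ∈ I, f(a) ⊏ f(b) implies a < b (where ⊏ denotes the strict order associated to ⊑). -/
/-- Let `I` be a partially ordered type and `f : I → J` a surjective map of underlying types
such that whenever `a < b` with `f a ≠ f b`, any representatives `a'` of `f a` and `b'` of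
`f b` satisfy `a' < b'`.  Then there exists exactly one partial order on `J` making `f`
monotone and satisfying the level condition: `f a < f b` implies `a < b`. -/
theorem unique_level_order {I J : Type*} [PartialOrder I] (f : I → J)
    (hsurj : Function.Surjective f)
    (h : ∀ a b a' b' : I, a < b → f a ≠ f b → f a' = f a → f b' = f b → a' < b') :
    ∃! o : PartialOrder J,
      (∀ a b : I, a ≤ b → o.le (f a) (f b)) ∧
      (∀ a b : I, o.lt (f a) (f b) → a < b) := by
  let o : PartialOrder J :=
    { le := fun x y => x = y ∨ ∀ a b, f a = x → f b = y → a < b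
      le_refl := fun x => Or.inl rfl
      le_trans := by
        rintro x y z (rfl | h1) (rfl | h2)
        · exact Or.inl rfl
        · exact Or.inr h2
        · exact Or.inr h1
        · obtain ⟨c, hc⟩ := hsurj y
          exact Or.inr fun a b ha hb => (h1 a c ha hc).trans (h2 c b hc hb)
      le_antisymm := by
        rintro x y (rfl | h1) (h2 | h2)
        · rfl
        · rfl
        · exact h2.symm
        · obtain ⟨a, ha⟩ := hsurj x
          obtain ⟨b, hb⟩ := hsurj y
          exact absurd (h1 a b ha hb) (h2 b a hb ha).asymm }
  refine ⟨o, ⟨?_, ?_⟩, ?_⟩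
  · intro a b hab
    by_cases e : f a = f b
    · exact Or.inl e
    · have hlt : a < b := lt_of_le_of_ne hab fun he => e (congrArg f he)
      exact Or.inr fun a' b' ha hb => h a b a' b' hlt e ha hb
  · rintro a b ⟨h1 | h1, h2⟩
    · exact absurd (Or.inl h1.symm) h2
    · exact h1 a b rfl rfl
  · rintro o' ⟨hm, hl⟩
    apply PartialOrder.ext
    intro x y
    constructor
    · intro hxy
      by_cases e : x = y
      · exact Or.inl e
      · refine Or.inr ?_
        rintro a b rfl rfl
        exact hl a b (@lt_of_le_of_ne J o' _ _ hxy e)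
    · rintro (rfl | h1)
      · exact o'.le_refl _
      · obtain ⟨a, rfl⟩ := hsurj x
        obtain ⟨b, rfl⟩ := hsurj y
        exact hm a b (h1 a b rfl rfl).le
end

section
/- Let I be a small partially ordered type, regarded as a category, let Iδ be the same underlying type with the discrete partial order (a ≤ b iff a = b), and let i : Iδ ⥤ I be the identity-on-objects functor. Then the induction functor i_! : (Iδ ⥤ ModuleCat ℂ) ⥤ (I ⥤ ModuleCat ℂ), given by pointwise left Kan extension along i, is full and faithful if and only if the order on I is trivial, i.e. for all a, b ∈ I, a ≤ b implies a = b. -/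
open CategoryTheory

/-- The underlying type of a poset `I`, equipped with the discrete partial order
(`a ≤ b` iff `a = b`). -/
def Delta (I : Type) : Type := I

instance Delta.instPartialOrder (I : Type) : PartialOrder (Delta I) where
  le a b := a = b
  le_refl _ := rfl
  le_trans _ _ _ h h' := Eq.trans h h'
  le_antisymm _ _ h _ := h

/-- The identity-on-objects functor from the discretization `Iδ` of `I` to `I`. -/
def deltaIncl (I : Type) [PartialOrder I] : Delta I ⥤ I :=
  Monotone.functor (f := fun a : Delta I => (a : I))
    (fun _ _ h => by exact le_of_eq h)

/-- The functor on the discretization which is `ℂ` at `a` and zero elsewhere. -/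
noncomputable def skyDelta (I : Type) (a : Delta I) : Delta I ⥤ ModuleCat.{0} ℂ where
  obj x := ModuleCat.of ℂ (PLift (x = a) →₀ ℂ)
  map {x y} f := ModuleCat.ofHom (Finsupp.lmapDomain ℂ ℂ
    (fun h => ⟨((show x = y from leOfHom f).symm.trans h.down)⟩))
  map_id x := by
    ext : 1
    exact Finsupp.lmapDomain_id ℂ ℂ
  map_comp f g := by
    ext : 1
    rw [ModuleCat.hom_comp, ModuleCat.hom_ofHom, ModuleCat.hom_ofHom, ModuleCat.hom_ofHom,
      ← Finsupp.lmapDomain_comp]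

/-- The sum map from the skyscraper functor to the constant functor. -/
noncomputable def skyMap (I : Type) [PartialOrder I] (a : Delta I) :
    skyDelta I a ⟶ deltaIncl I ⋙ (Functor.const I).obj (ModuleCat.of ℂ ℂ) where
  app x := ModuleCat.ofHom (Finsupp.linearCombination ℂ (fun _ => (1 : ℂ)))
  naturality x y f := by
    obtain rfl : x = y := leOfHom f
    obtain rfl : f = 𝟙 x := Subsingleton.elim _ _
    rw [CategoryTheory.Functor.map_id, CategoryTheory.Functor.map_id]
    exact (Category.id_comp _).trans (Category.comp_id _).symm

/-- Let `I` be a small partially ordered type, `Iδ` the same type with the discrete partial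
order, and `i : Iδ ⥤ I` the identity-on-objects functor.  The induction functor
`i_! : (Iδ ⥤ ModuleCat ℂ) ⥤ (I ⥤ ModuleCat ℂ)` given by pointwise left Kan extension
along `i` is full and faithful if and only if the order on `I` is trivial. -/
theorem lan_fullyFaithful_iff_discrete (I : Type) [PartialOrder I] :
    (((deltaIncl I).lan : (Delta I ⥤ ModuleCat.{0} ℂ) ⥤ (I ⥤ ModuleCat.{0} ℂ)).Full ∧
      ((deltaIncl I).lan : (Delta I ⥤ ModuleCat.{0} ℂ) ⥤ (I ⥤ ModuleCat.{0} ℂ)).Faithful)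
      ↔ (∀ a b : I, a ≤ b → a = b) := by
  constructor
  · rintro ⟨hfull, hfaith⟩ a b hab
    by_contra hne
    have hu : IsIso ((deltaIncl I).lanAdjunction (ModuleCat.{0} ℂ)).unit := inferInstance
    rw [Functor.lanAdjunction_unit] at hu
    let F := skyDelta I a
    let L : I ⥤ ModuleCat.{0} ℂ := (deltaIncl I).lan.obj F
    let u : F ⟶ deltaIncl I ⋙ L := (deltaIncl I).lanUnit.app F
    have hu1 : IsIso u := inferInstanceAs (IsIso ((deltaIncl I).lanUnit.app F))
    have hu2 : IsIso (u.app b) := NatIso.isIso_app_of_isIso u (show Delta I from b)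
    have hb : Limits.IsZero (F.obj b) := by
      have : IsEmpty (PLift ((b : Delta I) = a)) := ⟨fun h => hne h.down.symm⟩
      have : Subsingleton (F.obj b) :=
        inferInstanceAs (Subsingleton (PLift ((b : Delta I) = a) →₀ ℂ))
      exact ModuleCat.isZero_of_subsingleton _
    have hLb : Limits.IsZero (L.obj b) := hb.of_iso (asIso (u.app b)).symm
    let G : I ⥤ ModuleCat.{0} ℂ := (Functor.const I).obj (ModuleCat.of ℂ ℂ)
    have hL : L.IsLeftKanExtension u :=
      inferInstanceAs (((deltaIncl I).lan.obj F).IsLeftKanExtension ((deltaIncl I).lanUnit.app F))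
    let β : L ⟶ G := L.descOfIsLeftKanExtension u G (skyMap I a)
    have hfac : u.app a ≫ β.app a = (skyMap I a).app a :=
      L.descOfIsLeftKanExtension_fac_app u G (skyMap I a) a
    have hβ : β.app a = 0 := by
      have h1 : L.map (homOfLE hab) ≫ β.app b = β.app a ≫ G.map (homOfLE hab) :=
        β.naturality (homOfLE hab)
      have h2 : G.map (homOfLE hab) = 𝟙 _ := rfl
      rw [h2, Category.comp_id, hLb.eq_of_src (β.app b) 0, Limits.comp_zero] at h1
      exact h1.symm
    have h0 : (skyMap I a).app a = 0 := by
      rw [← hfac]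
      exact (congrArg (fun t => u.app a ≫ t) hβ).trans Limits.comp_zero
    have h3 : Finsupp.linearCombination ℂ (fun _ : PLift ((a : Delta I) = a) => (1 : ℂ)) = 0 :=
      congrArg ModuleCat.Hom.hom h0
    have h4 := LinearMap.congr_fun h3 (Finsupp.single ⟨rfl⟩ 1)
    simp at h4
  · intro h
    have : (deltaIncl I).Full := ⟨fun {x y} f => ⟨homOfLE (h _ _ (leOfHom f)), Subsingleton.elim _ _⟩⟩
    have : (deltaIncl I).Faithful := ⟨fun {x y} f g _ => Subsingleton.elim _ _⟩
    have hu : IsIso ((deltaIncl I).lanAdjunction (ModuleCat.{0} ℂ)).unit := by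
      rw [Functor.lanAdjunction_unit]
      infer_instance
    let ff := ((deltaIncl I).lanAdjunction (ModuleCat.{0} ℂ)).fullyFaithfulLOfIsIsoUnit
    exact ⟨ff.full, ff.faithful⟩
end
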